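/- Let n ≥ 1 and let F : (Fin n → Bool) → (Fin n → Bool) satisfy the hypotheses of the paper's sufficient condition for invertibility: there exist a permutation σ of Fin n, pairwise distinct indices j_0, …, j_{n-1}, and Boolean functions g_0, …, g_{n-1} such that for every k, f_{σ(k)}(x) = x_{j_k} XOR g_k(x) with g_k not depending on variable j_k, g_0 constant, and dep(g_k) ⊆ dep(f_{σ(0)}) ∪ … ∪ dep(f_{σ(k-1)}) for k ≥ 1. Then F is the composition of a bit permutation and an invertible T-function: there exist bijections α, β : Fin n ≃ Fin n and a bijective mapping T : (Fin n → Bool) → (Fin n → Bool) such that for each k the coordinate T(y) k depends only on the variables y_0, …, y_k, and F(x) m = T(fun k => x (α k)) (β m) for all x and all m. -/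

import Mathlib

/-- `h` does not depend on variable `i`. -/
def DoesNotDependOn {n : ℕ} (h : (Fin n → Bool) → Bool) (i : Fin n) : Prop :=
  ∀ (x : Fin n → Bool) (b : Bool), h x = h (Function.update x i b)

/-- The dependence set of `h`: the set of variables on which `h` depends. -/
def dep {n : ℕ} (h : (Fin n → Bool) → Bool) : Set (Fin n) :=
  {i | ¬ DoesNotDependOn h i}

/-- A Boolean function takes equal values at points that agree on its dependence set. -/
theorem eq_of_eqOn_dep {n : ℕ} (h : (Fin n → Bool) → Bool) {x y : Fin n → Bool}
    (hxy : ∀ i ∈ dep h, x i = y i) : h x = h y := by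
  have key : ∀ s : Finset (Fin n), h (s.piecewise y x) = h x := by
    intro s
    induction s using Finset.induction_on with
    | empty => simp
    | insert i s _ ih =>
      rw [Finset.piecewise_insert, ← ih]
      by_cases hi : i ∈ dep h
      · have hval : s.piecewise y x i = y i := by
          by_cases his : i ∈ s <;> simp [his, hxy i hi]
        rw [← hval, Function.update_eq_self]
      · exact (not_not.mp hi _ _).symm
  simpa using (key Finset.univ).symm

/-- Adding the variable `i` to a Boolean function adds at most `i` to its dependence set. -/
theorem dep_xor_subset {n : ℕ} (h : (Fin n → Bool) → Bool) (i : Fin n) :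
    dep (fun x => xor (x i) (h x)) ⊆ insert i (dep h) := by
  intro m hm
  by_contra hc
  rw [Set.mem_insert_iff, not_or] at hc
  refine hm fun x b => ?_
  simp only [Function.update_of_ne (Ne.symm hc.1), ← not_not.mp hc.2 x b]

/-- In a triangular system, the `k`-th function depends only on the first `k + 1` pivots. -/
theorem dep_subset_image_Iic {n : ℕ} {f g : Fin n → (Fin n → Bool) → Bool} {j : Fin n → Fin n}
    (hform : ∀ k x, f k x = xor (x (j k)) (g k x))
    (htri : ∀ k : Fin n, dep (g k) ⊆ ⋃ (m : Fin n) (_ : m < k), dep (f m)) (k : Fin n) :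
    dep (f k) ⊆ j '' Set.Iic k := by
  induction k using WellFoundedLT.induction with
  | ind k ih =>
    intro i hi
    rw [show f k = fun x => xor (x (j k)) (g k x) from funext (hform k)] at hi
    rcases dep_xor_subset _ _ hi with rfl | hg
    · exact ⟨k, le_refl k, rfl⟩
    · obtain ⟨m, hm, him⟩ := Set.mem_iUnion₂.mp (htri k hg)
      obtain ⟨l, hl, rfl⟩ := ih m hm him
      exact ⟨l, le_trans hl hm.le, rfl⟩

theorem decomposition_bit_permutation_tfunction
    (n : ℕ) (hn : 1 ≤ n)
    (F : (Fin n → Bool) → (Fin n → Bool))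
    (σ : Equiv.Perm (Fin n))
    (j : Fin n → Fin n) (hj : Function.Injective j)
    (g : Fin n → (Fin n → Bool) → Bool)
    (hform : ∀ (k : Fin n) (x : Fin n → Bool), F x (σ k) = xor (x (j k)) (g k x))
    (hfree : ∀ k : Fin n, DoesNotDependOn (g k) (j k))
    (htri : ∀ k : Fin n,
      dep (g k) ⊆ ⋃ (m : Fin n) (_ : m < k), dep (fun x => F x (σ m))) :
    ∃ (α β : Fin n ≃ Fin n) (T : (Fin n → Bool) → (Fin n → Bool)),
      Function.Bijective T ∧
      (∀ (k m : Fin n), k < m → DoesNotDependOn (fun y => T y k) m) ∧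
      (∀ (x : Fin n → Bool) (m : Fin n), F x m = T (fun k => x (α k)) (β m)) := by
  have hdep (k : Fin n) : dep (fun x => F x (σ k)) ⊆ j '' Set.Iic k :=
    dep_subset_image_Iic (f := fun k x => F x (σ k)) hform htri k
  let α : Fin n ≃ Fin n := Equiv.ofBijective j (Finite.injective_iff_bijective.mp hj)
  have hα (k : Fin n) : α.symm (j k) = k := α.symm_apply_apply k
  refine ⟨α, σ.symm, fun y k => F (y ∘ α.symm) (σ k), ?_, ?_, ?_⟩
  · refine Finite.injective_iff_bijective.mp fun y z hyz => funext fun k => ?_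
    induction k using WellFoundedLT.induction with
    | ind k ih =>
      have hg : g k (y ∘ α.symm) = g k (z ∘ α.symm) := by
        refine eq_of_eqOn_dep _ fun i hi => ?_
        obtain ⟨m, hm, him⟩ := Set.mem_iUnion₂.mp (htri k hi)
        obtain ⟨l, hl, rfl⟩ := hdep m him
        simpa [hα] using ih l (lt_of_le_of_lt hl hm)
      have hk : F (y ∘ α.symm) (σ k) = F (z ∘ α.symm) (σ k) := congrFun hyz k
      rw [hform, hform, hg] at hk
      simpa [hα] using hk
  · intro k m hkm y b
    refine eq_of_eqOn_dep (fun x => F x (σ k)) fun i hi => ?_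
    obtain ⟨l, hl, rfl⟩ := hdep k hi
    simp [hα, Function.update_of_ne (lt_of_le_of_lt hl hkm).ne]
  · intro x m
    have hx : (fun k => x (α k)) ∘ α.symm = x := by ext i; simp
    simp only [hx, Equiv.apply_symm_apply]
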